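/- arXiv:quant-ph/0401134 — 5 statements merged into one kernel-verified Lean document; each statement's English description precedes it below -/
import Mathlib

section
/- For all binary vectors a, b, c, d : Fin N → ZMod 2, the N-qubit Pauli operators W(a|b) and W(c|d) commute (W(a|b) · W(c|d) = W(c|d) · W(a|b)) if and only if ∑_i (a i · d i + b i · c i) = 0 in ZMod 2. -/
open Matrix

/-- The single-qubit Pauli `X` matrix. -/
noncomputable def PauliX : Matrix (Fin 2) (Fin 2) ℂ := !![0, 1; 1, 0]

/-- The single-qubit Pauli `Z` matrix. -/
noncomputable def PauliZ : Matrix (Fin 2) (Fin 2) ℂ := !![1, 0; 0, -1]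

/-- The single-qubit Pauli factor `X^a Z^b` for `a b : ZMod 2`. -/
noncomputable def pauliFactor (a b : ZMod 2) : Matrix (Fin 2) (Fin 2) ℂ :=
  PauliX ^ a.val * PauliZ ^ b.val

/-- The `N`-qubit Pauli operator `W(a|b)`, the Kronecker product of the single-qubit
factors `X^(a i) Z^(b i)`. -/
noncomputable def PauliW {N : ℕ} (a b : Fin N → ZMod 2) :
    Matrix (Fin N → Fin 2) (Fin N → Fin 2) ℂ :=
  Matrix.of fun x y => ∏ i, pauliFactor (a i) (b i) (x i) (y i)

/-- The nontrivial additive character `s ↦ (-1)^s` of `ZMod 2`. -/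
noncomputable def signChar : AddChar (ZMod 2) ℂ where
  toFun s := (-1) ^ s.val
  map_zero_eq_one' := by simp
  map_add_eq_mul' s t := by
    rw [← pow_add, ZMod.val_add, ← neg_one_pow_eq_pow_mod_two]

theorem signChar_apply (s : ZMod 2) : signChar s = (-1) ^ s.val := rfl

theorem signChar_one : signChar 1 = -1 := by
  simp [signChar_apply, ZMod.val_one]

theorem signChar_sum {ι : Type*} (s : Finset ι) (f : ι → ZMod 2) :
    signChar (∑ i ∈ s, f i) = ∏ i ∈ s, signChar (f i) :=
  map_prod signChar.toMonoidHom (fun i => Multiplicative.ofAdd (f i)) s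

theorem signChar_eq_one_iff (s : ZMod 2) : signChar s = 1 ↔ s = 0 := by
  rw [signChar_apply, neg_one_pow_eq_one_iff_even (by norm_num)]
  revert s
  decide

theorem PauliX_mul_self : PauliX * PauliX = 1 := by
  simp [PauliX, Matrix.one_fin_two]

theorem PauliZ_mul_self : PauliZ * PauliZ = 1 := by
  simp [PauliZ, Matrix.one_fin_two]

/-- Single-qubit Pauli factors commute up to the sign of their symplectic pairing. -/
theorem pauliFactor_mul_comm (a b c d : ZMod 2) :
    pauliFactor a b * pauliFactor c d =
      signChar (a * d + b * c) • (pauliFactor c d * pauliFactor a b) := by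
  have zero_or_one : ∀ z : ZMod 2, z = 0 ∨ z = 1 := by decide
  rcases zero_or_one a with rfl | rfl <;> rcases zero_or_one b with rfl | rfl <;>
    rcases zero_or_one c with rfl | rfl <;> rcases zero_or_one d with rfl | rfl <;>
    simp [pauliFactor, PauliX, PauliZ, signChar_one, ZMod.val_one, CharTwo.add_self_eq_zero]

theorem isUnit_pauliFactor (a b : ZMod 2) : IsUnit (pauliFactor a b) :=
  ((IsUnit.of_mul_eq_one _ PauliX_mul_self).pow _).mul
    ((IsUnit.of_mul_eq_one _ PauliZ_mul_self).pow _)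

theorem PauliW_mul_apply {N : ℕ} (a b c d : Fin N → ZMod 2) (x y : Fin N → Fin 2) :
    (PauliW a b * PauliW c d) x y =
      ∏ i, (pauliFactor (a i) (b i) * pauliFactor (c i) (d i)) (x i) (y i) := by
  simp only [Matrix.mul_apply, PauliW, Matrix.of_apply, ← Finset.prod_mul_distrib]
  rw [Finset.prod_univ_sum, Fintype.piFinset_univ]

/-- Pauli operators commute up to the sign of their symplectic pairing. -/
theorem PauliW_mul_comm {N : ℕ} (a b c d : Fin N → ZMod 2) :
    PauliW a b * PauliW c d =
      signChar (∑ i, (a i * d i + b i * c i)) • (PauliW c d * PauliW a b) := by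
  ext x y
  rw [Matrix.smul_apply, PauliW_mul_apply, PauliW_mul_apply, signChar_sum,
    smul_eq_mul, ← Finset.prod_mul_distrib]
  refine Finset.prod_congr rfl fun i _ => ?_
  rw [pauliFactor_mul_comm, Matrix.smul_apply, smul_eq_mul]

theorem PauliW_mul_ne_zero {N : ℕ} (a b c d : Fin N → ZMod 2) :
    PauliW a b * PauliW c d ≠ 0 := by
  have entry (i : Fin N) :
      ∃ x y, (pauliFactor (a i) (b i) * pauliFactor (c i) (d i)) x y ≠ 0 := by
    by_contra! h
    exact ((isUnit_pauliFactor (a i) (b i)).mul (isUnit_pauliFactor (c i) (d i))).ne_zero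
      (Matrix.ext h)
  choose x y hxy using entry
  intro h
  have hprod := PauliW_mul_apply a b c d x y
  rw [h, Matrix.zero_apply] at hprod
  exact Finset.prod_ne_zero_iff.mpr (fun i _ => hxy i) hprod.symm

/-- Two `N`-qubit Pauli operators `W(a|b)` and `W(c|d)` commute if and only if the
symplectic pairing `∑ i, a i * d i + b i * c i` vanishes in `ZMod 2`. -/
theorem pauli_commute_iff {N : ℕ} (a b c d : Fin N → ZMod 2) :
    PauliW a b * PauliW c d = PauliW c d * PauliW a b ↔
      ∑ i, (a i * d i + b i * c i) = 0 := by
  rw [PauliW_mul_comm, ← signChar_eq_one_iff]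
  refine ⟨fun h => ?_, fun h => by rw [h, one_smul]⟩
  refine smul_left_injective ℂ (PauliW_mul_ne_zero c d a b) ?_
  simpa using h
end

section
/- Let P_X, P_Z, Q_X, Q_Z : ℕ → Fin n → ZMod 2 be finitely supported sequences of binary vectors. Then the following are equivalent: (1) for all natural numbers r and s, ∑_{l} ( ⟨P_X^{(l+s)}, Q_Z^{(l+r)}⟩ + ⟨P_Z^{(l+s)}, Q_X^{(l+r)}⟩ ) = 0 in ZMod 2 (the sum over all integers l for which the indices are nonnegative); (2) the Laurent polynomial ∑_{i : Fin n} ( P_{X,i}(D) · Q_{Z,i}(D⁻¹) + P_{Z,i}(D) · Q_{X,i}(D⁻¹) ) is zero in LaurentPolynomial (ZMod 2). -/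
open LaurentPolynomial

/-- `P_i(D) = ∑_j P^{(j)}(i) • D^j` as a Laurent polynomial over `ZMod 2`. -/
noncomputable def seqPolyD {n : ℕ} (P : ℕ → Fin n → ZMod 2) (i : Fin n) :
    LaurentPolynomial (ZMod 2) :=
  ∑ᶠ j : ℕ, P j i • T (j : ℤ)

/-- `P_i(D⁻¹) = ∑_j P^{(j)}(i) • D^{-j}` as a Laurent polynomial over `ZMod 2`. -/
noncomputable def seqPolyDInv {n : ℕ} (P : ℕ → Fin n → ZMod 2) (i : Fin n) :
    LaurentPolynomial (ZMod 2) :=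
  ∑ᶠ j : ℕ, P j i • T (-(j : ℤ))

/-- Extension by zero of a sequence of binary vectors to integer indices. -/
def extZero {n : ℕ} (P : ℕ → Fin n → ZMod 2) (l : ℤ) : Fin n → ZMod 2 :=
  if 0 ≤ l then P l.toNat else 0

/-- Inner product of two binary vectors in `ZMod 2`. -/
def inner2 {n : ℕ} (u v : Fin n → ZMod 2) : ZMod 2 := ∑ i, u i * v i

theorem LaurentPolynomial.coeff_mul_eq_finsum {R : Type*} [Semiring R]
    (p q : LaurentPolynomial R) (k : ℤ) :
    (p * q).coeff k = ∑ᶠ a : ℤ, p.coeff a * q.coeff (k - a) := by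
  classical
  have hsupp : (Function.support fun a : ℤ => p.coeff a * q.coeff (k - a)) ⊆
      (p.coeff.support : Set ℤ) := by
    intro a ha
    exact Finsupp.mem_support_iff.2 (left_ne_zero_of_mul ha)
  rw [finsum_eq_sum_of_support_subset _ hsupp, AddMonoidAlgebra.coeff_mul, Finsupp.sum]
  refine Finset.sum_congr rfl fun a _ => ?_
  have key : ∀ b : ℤ, a + b = k ↔ k - a = b := fun b => by omega
  simp only [key, Finsupp.sum_ite_eq]
  split_ifs with h
  · rfl
  · rw [Finsupp.notMem_support_iff.1 h, mul_zero]

theorem LaurentPolynomial.coeff_finsum_smul_T {R ι : Type*} [Semiring R] {c : ι → R}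
    (hc : (Function.support c).Finite) (e : ι → ℤ) (a : ℤ) :
    (∑ᶠ j, c j • (T (e j) : LaurentPolynomial R)).coeff a =
      ∑ᶠ j, if e j = a then c j else 0 := by
  have h₁ : (Function.support fun j => c j • (T (e j) : LaurentPolynomial R)) ⊆
      (hc.toFinset : Set ι) := by
    intro j hj
    rw [hc.coe_toFinset]
    intro h
    exact hj (by simp [h])
  have h₂ : (Function.support fun j => if e j = a then c j else 0) ⊆
      (hc.toFinset : Set ι) := by
    intro j hj
    rw [hc.coe_toFinset]
    intro h
    exact hj (by simp [h])
  rw [finsum_eq_sum_of_support_subset _ h₁, finsum_eq_sum_of_support_subset _ h₂,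
    AddMonoidAlgebra.coeff_sum, Finsupp.finsetSum_apply]
  simp

theorem finite_support_apply {n : ℕ} {P : ℕ → Fin n → ZMod 2}
    (hP : (Function.support P).Finite) (i : Fin n) :
    (Function.support fun j => P j i).Finite :=
  hP.subset fun _ hj h => hj (congrFun h i)

theorem finsum_ite_natCast_eq {n : ℕ} (P : ℕ → Fin n → ZMod 2) (i : Fin n) (a : ℤ) :
    (∑ᶠ j : ℕ, if (j : ℤ) = a then P j i else 0) = extZero P a i := by
  unfold extZero
  split_ifs with ha
  · lift a to ℕ using ha
    rw [finsum_eq_single _ a fun j hj => if_neg (by exact_mod_cast hj)]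
    simp
  · exact finsum_eq_zero_of_forall_eq_zero fun j => if_neg (by omega)

theorem coeff_seqPolyD {n : ℕ} {P : ℕ → Fin n → ZMod 2}
    (hP : (Function.support P).Finite) (i : Fin n) (a : ℤ) :
    (seqPolyD P i).coeff a = extZero P a i := by
  rw [seqPolyD, LaurentPolynomial.coeff_finsum_smul_T (finite_support_apply hP i),
    finsum_ite_natCast_eq]

theorem coeff_seqPolyDInv {n : ℕ} {P : ℕ → Fin n → ZMod 2}
    (hP : (Function.support P).Finite) (i : Fin n) (a : ℤ) :
    (seqPolyDInv P i).coeff a = extZero P (-a) i := by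
  rw [seqPolyDInv, LaurentPolynomial.coeff_finsum_smul_T (finite_support_apply hP i)]
  simp only [neg_eq_iff_eq_neg, finsum_ite_natCast_eq]

theorem finite_support_extZero_add {n : ℕ} {P : ℕ → Fin n → ZMod 2}
    (hP : (Function.support P).Finite) (s : ℤ) :
    (Function.support fun l : ℤ => extZero P (l + s)).Finite := by
  refine (hP.image fun j : ℕ => (j : ℤ) - s).subset fun l hl => ?_
  rw [Function.mem_support, extZero] at hl
  split_ifs at hl with h
  · exact ⟨(l + s).toNat, hl, by simp only [Int.toNat_of_nonneg h, add_sub_cancel_right]⟩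
  · exact absurd rfl hl

theorem finite_support_inner2_extZero {n : ℕ} {P : ℕ → Fin n → ZMod 2}
    (hP : (Function.support P).Finite) (Q : ℕ → Fin n → ZMod 2) (s r : ℤ) :
    (Function.support fun l : ℤ => inner2 (extZero P (l + s)) (extZero Q (l + r))).Finite :=
  (finite_support_extZero_add hP s).subset fun l hl h => hl (by simp [inner2, h])

theorem coeff_sum_seqPolyD_mul_seqPolyDInv {n : ℕ} {P Q : ℕ → Fin n → ZMod 2}
    (hP : (Function.support P).Finite) (hQ : (Function.support Q).Finite) (s r : ℤ) :
    (∑ i, seqPolyD P i * seqPolyDInv Q i).coeff (s - r) =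
      ∑ᶠ l : ℤ, inner2 (extZero P (l + s)) (extZero Q (l + r)) := by
  unfold inner2
  rw [finsum_sum_comm _ _ fun i _ => (finite_support_extZero_add hP s).subset
      fun l hl h => hl (by simp [h]),
    AddMonoidAlgebra.coeff_sum, Finsupp.finsetSum_apply]
  refine Finset.sum_congr rfl fun i _ => ?_
  rw [LaurentPolynomial.coeff_mul_eq_finsum, ← finsum_comp_equiv (Equiv.addRight s)]
  refine finsum_congr fun l => ?_
  rw [coeff_seqPolyD hP, coeff_seqPolyDInv hQ, Equiv.coe_addRight,
    show -(s - r - (l + s)) = l + r by ring]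

/-- For finitely supported sequences of binary vectors, all the `n`-qubit shifted versions
of the Pauli operator represented by `(P_X|P_Z)` commute with all the `n`-qubit shifted
versions of the one represented by `(Q_X|Q_Z)` — i.e. for all `r s : ℕ` the pairing
`∑_l ⟨P_X^{(l+s)}, Q_Z^{(l+r)}⟩ + ⟨P_Z^{(l+s)}, Q_X^{(l+r)}⟩` vanishes — if and only if
the Laurent polynomial `∑ i, P_{X,i}(D) Q_{Z,i}(D⁻¹) + P_{Z,i}(D) Q_{X,i}(D⁻¹)` is zero. -/
theorem pairing_vanishes_iff {n : ℕ} (PX PZ QX QZ : ℕ → Fin n → ZMod 2)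
    (hPX : (Function.support PX).Finite) (hPZ : (Function.support PZ).Finite)
    (hQX : (Function.support QX).Finite) (hQZ : (Function.support QZ).Finite) :
    (∀ r s : ℕ,
      (∑ᶠ l : ℤ, (inner2 (extZero PX (l + s)) (extZero QZ (l + r)) +
        inner2 (extZero PZ (l + s)) (extZero QX (l + r)))) = 0) ↔
      (∑ i : Fin n, (seqPolyD PX i * seqPolyDInv QZ i + seqPolyD PZ i * seqPolyDInv QX i))
        = 0 := by
  have key (s r : ℤ) :
      (∑ i, (seqPolyD PX i * seqPolyDInv QZ i + seqPolyD PZ i * seqPolyDInv QX i)).coeff (s - r) =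
        ∑ᶠ l : ℤ, (inner2 (extZero PX (l + s)) (extZero QZ (l + r)) +
          inner2 (extZero PZ (l + s)) (extZero QX (l + r))) := by
    rw [Finset.sum_add_distrib, AddMonoidAlgebra.coeff_add, Finsupp.add_apply,
      coeff_sum_seqPolyD_mul_seqPolyDInv hPX hQZ, coeff_sum_seqPolyD_mul_seqPolyDInv hPZ hQX,
      finsum_add_distrib (finite_support_inner2_extZero hPX QZ s r)
        (finite_support_inner2_extZero hPZ QX s r)]
  refine ⟨fun h => LaurentPolynomial.ext fun k => ?_, fun h r s => ?_⟩
  · rw [← Int.toNat_sub_toNat_neg k, key, h]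
    rfl
  · rw [← key, h]
    rfl
end

section
/- Fix a block size n ≥ 1, an overlap m ≥ 0, a number of blocks p ≥ 2, syndrome constraints C_j for j < p, and per-position weights w. Suppose E : Fin (p·n + m) → Fin 4 is a candidate up to block p−1 that maximizes the likelihood L among all candidates up to block p−1. Then the restriction E' of E to the first (p−1)·n + m positions is a candidate up to block p−2, and E' maximizes L among all candidates up to block p−2 whose values on the last m positions (positions (p−1)·n, …, (p−1)·n + m − 1) agree with those of E'. -/
/-- `e : Fin ((j+1)*n + m) → Fin 4` is an error candidate up to block `j`: for every
`j' ≤ j`, the restriction of `e` to block `j'` (the `n+m` positions starting at `j'*n`)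
satisfies the syndrome constraint `C j'`. -/
def Candidate (n m : ℕ) (C : ℕ → (Fin (n + m) → Fin 4) → Prop) (j : ℕ)
    (e : Fin ((j + 1) * n + m) → Fin 4) : Prop :=
  ∀ j', ∀ hj' : j' ≤ j, C j' fun q : Fin (n + m) =>
    e ⟨j' * n + q.val, by
      have h1 : j' * n ≤ j * n := Nat.mul_le_mul_right n hj'
      have h2 : (q : ℕ) < n + m := q.isLt
      have h3 : (j + 1) * n + m = j * n + (n + m) := by ring
      omega⟩

/-- The likelihood of an error pattern, for a memoryless channel with per-position
log-probabilities `w`. -/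
noncomputable def likelihood {M : ℕ} (w : ℕ → Fin 4 → ℝ) (e : Fin M → Fin 4) : ℝ :=
  ∑ q : Fin M, w q.val (e q)

/-- If two patterns agree from position `a` on, comparing their likelihoods amounts to comparing
the likelihoods of their restrictions to the first `a` positions. -/
theorem likelihood_castLE_le_of_likelihood_le {a b : ℕ} (hab : a ≤ b) (w : ℕ → Fin 4 → ℝ)
    {e₁ e₂ : Fin b → Fin 4} (hagree : ∀ q : Fin b, a ≤ q.val → e₁ q = e₂ q)
    (hle : likelihood w e₁ ≤ likelihood w e₂) :
    likelihood w (fun q : Fin a => e₁ (Fin.castLE hab q)) ≤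
      likelihood w (fun q : Fin a => e₂ (Fin.castLE hab q)) := by
  obtain ⟨d, rfl⟩ := Nat.exists_eq_add_of_le hab
  have htail : ∑ i : Fin d, w (Fin.natAdd a i).val (e₁ (Fin.natAdd a i)) =
      ∑ i : Fin d, w (Fin.natAdd a i).val (e₂ (Fin.natAdd a i)) :=
    Finset.sum_congr rfl fun i _ => by rw [hagree _ (by simp)]
  unfold likelihood at hle ⊢
  rw [Fin.sum_univ_add, Fin.sum_univ_add, htail] at hle
  exact le_of_add_le_add_right hle

/-- If `E` is a maximum-likelihood candidate up to block `p-1`, then its restriction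
`E'` to the first `(p-1)*n + m` positions is a candidate up to block `p-2` which
maximizes the likelihood among all candidates up to block `p-2` agreeing with `E'` on
the last `m` positions (positions `(p-1)*n, …, (p-1)*n + m - 1`). -/
theorem viterbi_truncation (n m p : ℕ) (hn : 1 ≤ n) (hp : 2 ≤ p)
    (C : ℕ → (Fin (n + m) → Fin 4) → Prop) (w : ℕ → Fin 4 → ℝ)
    (E : Fin ((p - 1 + 1) * n + m) → Fin 4)
    (hE : Candidate n m C (p - 1) E)
    (hmax : ∀ e : Fin ((p - 1 + 1) * n + m) → Fin 4,
      Candidate n m C (p - 1) e → likelihood w e ≤ likelihood w E) :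
    Candidate n m C (p - 2)
      (fun q => E (Fin.castLE
        (Nat.add_le_add_right (Nat.mul_le_mul_right n (by omega : p - 2 + 1 ≤ p - 1 + 1)) m) q)) ∧
    ∀ e' : Fin ((p - 2 + 1) * n + m) → Fin 4,
      Candidate n m C (p - 2) e' →
      (∀ q : Fin m, e' ⟨(p - 2 + 1) * n + q.val, by omega⟩ =
        E (Fin.castLE
          (Nat.add_le_add_right (Nat.mul_le_mul_right n (by omega : p - 2 + 1 ≤ p - 1 + 1)) m)
          ⟨(p - 2 + 1) * n + q.val, by omega⟩)) →
      likelihood w e' ≤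
        likelihood w (fun q : Fin ((p - 2 + 1) * n + m) => E (Fin.castLE
          (Nat.add_le_add_right (Nat.mul_le_mul_right n (by omega : p - 2 + 1 ≤ p - 1 + 1)) m)
          q)) := by
  obtain ⟨k, rfl⟩ := Nat.exists_eq_add_of_le' hp
  refine ⟨fun j' hj' => hE j' (hj'.trans (by omega)), fun e' he' hagree => ?_⟩
  have hab : (k + 1) * n + m ≤ (k + 1 + 1) * n + m :=
    Nat.add_le_add_right (Nat.mul_le_mul_right n (by omega)) m
  let g : Fin ((k + 1 + 1) * n + m) → Fin 4 := fun q =>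
    if h : q.val < (k + 1) * n + m then e' ⟨q.val, h⟩ else E q
  have hg : Candidate n m C (k + 1) g := by
    intro j' hj'
    rcases Nat.lt_or_ge k j' with hk | hk
    · obtain rfl : j' = k + 1 := by omega
      convert hE (k + 1) le_rfl using 1
      funext q
      by_cases h : (k + 1) * n + q.val < (k + 1) * n + m
      · exact (dif_pos h).trans (hagree ⟨q.val, by omega⟩)
      · exact dif_neg h
    · convert he' j' hk using 1
      funext q
      exact dif_pos _
  have hge : (fun q : Fin ((k + 1) * n + m) => g (Fin.castLE hab q)) = e' :=
    funext fun q => dif_pos q.isLt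
  have hle := likelihood_castLE_le_of_likelihood_le hab w
    (fun q hq => dif_neg (not_lt.mpr hq)) (hmax g hg)
  rw [hge] at hle
  exact hle
end

section
/- Fix a block size n ≥ 1, an overlap m ≥ 0, syndrome constraints C_j, and per-position weights w. For j ∈ ℕ and a suffix σ : Fin m → Fin 4, let Best(j, σ) denote the maximum of the likelihood L over the (finite) set of candidates up to block j whose values on their last m positions equal σ, whenever this set is nonempty. Then for every j and every suffix σ' : Fin m → Fin 4 such that candidates up to block j+1 with suffix σ' exist: Best(j+1, σ') equals the maximum, over all pairs (σ, x) with σ : Fin m → Fin 4 and x : Fin n → Fin 4 such that (i) candidates up to block j with suffix σ exist, (ii) the concatenated window σ ⧺ x : Fin (m+n) → Fin 4 satisfies C_{j+1}, and (iii) the length-m suffix of σ ⧺ x equals σ', of the quantity Best(j, σ) + ∑_{q < n} w ((j+1)·n + m + q) (x q). -/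
/-- The values of a candidate up to block `j` on its last `m` positions. -/
def suffixOf (n m : ℕ) (j : ℕ) (e : Fin ((j + 1) * n + m) → Fin 4) : Fin m → Fin 4 :=
  fun q => e ⟨(j + 1) * n + q.val, by omega⟩

/-- The set of candidates up to block `j` whose last `m` values equal `σ`. -/
def CandSet (n m : ℕ) (C : ℕ → (Fin (n + m) → Fin 4) → Prop) (j : ℕ)
    (σ : Fin m → Fin 4) : Set (Fin ((j + 1) * n + m) → Fin 4) :=
  {e | Candidate n m C j e ∧ suffixOf n m j e = σ}

/-- Best cumulative likelihood of a candidate up to block `j` with suffix `σ`. -/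
noncomputable def Best (n m : ℕ) (C : ℕ → (Fin (n + m) → Fin 4) → Prop)
    (w : ℕ → Fin 4 → ℝ) (j : ℕ) (σ : Fin m → Fin 4) : ℝ :=
  sSup (likelihood w '' CandSet n m C j σ)

/-- The window of block `j+1`: the old suffix `σ` on the first `m` positions followed
by the `n` new letters `x`. -/
def windowAppend (n m : ℕ) (σ : Fin m → Fin 4) (x : Fin n → Fin 4) :
    Fin (n + m) → Fin 4 :=
  fun q => if h : q.val < m then σ ⟨q.val, h⟩ else x ⟨q.val - m, by omega⟩

theorem succ_block_length (n m j : ℕ) : (j + 1 + 1) * n + m = (j + 1) * n + m + n := by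
  ring

/-- The error pattern up to block `j + 1` obtained by appending `n` new letters `x` to `e`. -/
def extendBlock (n m j : ℕ) (e : Fin ((j + 1) * n + m) → Fin 4) (x : Fin n → Fin 4) :
    Fin ((j + 1 + 1) * n + m) → Fin 4 :=
  fun q => if h : q.val < (j + 1) * n + m then e ⟨q.val, h⟩
    else x ⟨q.val - ((j + 1) * n + m), by have := q.isLt; have := succ_block_length n m j; omega⟩

theorem exists_extendBlock_eq (n m j : ℕ) (e' : Fin ((j + 1 + 1) * n + m) → Fin 4) :
    ∃ e x, extendBlock n m j e x = e' := by
  have hlen := succ_block_length n m j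
  refine ⟨fun q => e' ⟨q.val, by omega⟩,
    fun q => e' ⟨(j + 1) * n + m + q.val, by omega⟩, funext fun q => ?_⟩
  unfold extendBlock
  split_ifs with h
  · rfl
  · exact congrArg e' (Fin.ext (by simp only; omega))

theorem Fin.sum_univ_of_eq_add {R : Type*} [AddCommMonoid R] {M N n : ℕ} (h : M = N + n)
    (f : Fin M → R) :
    ∑ q, f q = ∑ q : Fin N, f ⟨q.val, by omega⟩ + ∑ q : Fin n, f ⟨N + q.val, by omega⟩ := by
  subst h
  exact Fin.sum_univ_add f

theorem likelihood_extendBlock (n m j : ℕ) (w : ℕ → Fin 4 → ℝ)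
    (e : Fin ((j + 1) * n + m) → Fin 4) (x : Fin n → Fin 4) :
    likelihood w (extendBlock n m j e x) =
      likelihood w e + ∑ q : Fin n, w ((j + 1) * n + m + q.val) (x q) := by
  unfold likelihood
  rw [Fin.sum_univ_of_eq_add (succ_block_length n m j)]
  simp [extendBlock]

theorem extendBlock_last_window (n m j : ℕ) (e : Fin ((j + 1) * n + m) → Fin 4)
    (x : Fin n → Fin 4) (q : Fin (n + m)) (h : (j + 1) * n + q.val < (j + 1 + 1) * n + m) :
    extendBlock n m j e x ⟨(j + 1) * n + q.val, h⟩ =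
      windowAppend n m (suffixOf n m j e) x q := by
  unfold extendBlock windowAppend suffixOf
  by_cases hq : q.val < m
  · simp [hq]
  · simp [hq, Nat.add_sub_add_left]

theorem candidate_extendBlock_iff (n m j : ℕ) (C : ℕ → (Fin (n + m) → Fin 4) → Prop)
    (e : Fin ((j + 1) * n + m) → Fin 4) (x : Fin n → Fin 4) :
    Candidate n m C (j + 1) (extendBlock n m j e x) ↔
      Candidate n m C j e ∧ C (j + 1) (windowAppend n m (suffixOf n m j e) x) := by
  have hold : ∀ j' ≤ j, ∀ q : Fin (n + m), j' * n + q.val < (j + 1) * n + m := by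
    intro j' hj' q
    have h1 : j' * n ≤ j * n := Nat.mul_le_mul_right n hj'
    have h2 : (j + 1) * n + m = j * n + (n + m) := by ring
    omega
  constructor
  · intro h
    refine ⟨fun j' hj' => ?_, ?_⟩
    · simpa only [extendBlock, hold j' hj', dite_true] using h j' (by omega)
    · simpa only [extendBlock_last_window] using h (j + 1) le_rfl
  · rintro ⟨he, hlast⟩ j' hj'
    rcases Nat.le_succ_iff.mp hj' with hj | rfl
    · simpa only [extendBlock, hold j' hj, dite_true] using he j' hj
    · simpa only [extendBlock_last_window] using hlast

theorem suffixOf_extendBlock (n m j : ℕ) (e : Fin ((j + 1) * n + m) → Fin 4)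
    (x : Fin n → Fin 4) (q : Fin m) :
    suffixOf n m (j + 1) (extendBlock n m j e x) q =
      windowAppend n m (suffixOf n m j e) x (Fin.natAdd n q) := by
  rw [← extendBlock_last_window n m j e x _ (by have := succ_block_length n m j; grind)]
  exact congrArg (extendBlock n m j e x) (Fin.ext (by simp only [Fin.val_natAdd]; ring))

theorem extendBlock_mem_candSet_iff (n m j : ℕ) (C : ℕ → (Fin (n + m) → Fin 4) → Prop)
    (e : Fin ((j + 1) * n + m) → Fin 4) (x : Fin n → Fin 4) (σ' : Fin m → Fin 4) :
    extendBlock n m j e x ∈ CandSet n m C (j + 1) σ' ↔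
      e ∈ CandSet n m C j (suffixOf n m j e) ∧
        C (j + 1) (windowAppend n m (suffixOf n m j e) x) ∧
        ∀ q : Fin m, windowAppend n m (suffixOf n m j e) x (Fin.natAdd n q) = σ' q := by
  simp only [CandSet, Set.mem_ofPred_eq, candidate_extendBlock_iff, funext_iff,
    suffixOf_extendBlock, implies_true, and_true, and_assoc]

theorem likelihood_le_best {n m j : ℕ} {C : ℕ → (Fin (n + m) → Fin 4) → Prop}
    (w : ℕ → Fin 4 → ℝ) {σ : Fin m → Fin 4} {e : Fin ((j + 1) * n + m) → Fin 4}
    (he : e ∈ CandSet n m C j σ) : likelihood w e ≤ Best n m C w j σ :=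
  le_csSup ((Set.toFinite _).image _).bddAbove (Set.mem_image_of_mem _ he)

theorem exists_likelihood_eq_best {n m j : ℕ} {C : ℕ → (Fin (n + m) → Fin 4) → Prop}
    (w : ℕ → Fin 4 → ℝ) {σ : Fin m → Fin 4} (h : (CandSet n m C j σ).Nonempty) :
    ∃ e ∈ CandSet n m C j σ, likelihood w e = Best n m C w j σ :=
  (h.image _).csSup_mem ((Set.toFinite _).image _)

/-- Bellman recursion of the quantum Viterbi algorithm: the best likelihood of a
candidate up to block `j+1` with suffix `σ'` is the maximum over all `(σ, x)` —
with candidates up to block `j` with suffix `σ` existing, the window `σ ⧺ x`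
satisfying the syndrome constraint `C (j+1)`, and the length-`m` suffix of `σ ⧺ x`
equal to `σ'` — of `Best j σ` plus the weight of the `n` new letters `x`. -/
theorem viterbi_bellman (n m : ℕ) (hn : 1 ≤ n)
    (C : ℕ → (Fin (n + m) → Fin 4) → Prop) (w : ℕ → Fin 4 → ℝ)
    (j : ℕ) (σ' : Fin m → Fin 4)
    (hne : (CandSet n m C (j + 1) σ').Nonempty) :
    Best n m C w (j + 1) σ' =
      sSup {y : ℝ | ∃ σ : Fin m → Fin 4, ∃ x : Fin n → Fin 4,
        (CandSet n m C j σ).Nonempty ∧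
        C (j + 1) (windowAppend n m σ x) ∧
        (∀ q : Fin m, windowAppend n m σ x ⟨n + q.val, by omega⟩ = σ' q) ∧
        y = Best n m C w j σ + ∑ q : Fin n, w ((j + 1) * n + m + q.val) (x q)} := by
  have hupper : ∀ (σ : Fin m → Fin 4) (x : Fin n → Fin 4), (CandSet n m C j σ).Nonempty →
      C (j + 1) (windowAppend n m σ x) →
      (∀ q : Fin m, windowAppend n m σ x ⟨n + q.val, by omega⟩ = σ' q) →
      Best n m C w j σ + ∑ q : Fin n, w ((j + 1) * n + m + q.val) (x q) ≤
        Best n m C w (j + 1) σ' := by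
    intro σ x hσ hC hsuf
    obtain ⟨e, he, hbest⟩ := exists_likelihood_eq_best w hσ
    rw [← hbest, ← likelihood_extendBlock]
    obtain ⟨-, rfl⟩ := id he
    exact likelihood_le_best w ((extendBlock_mem_candSet_iff n m j C e x σ').2 ⟨he, hC, hsuf⟩)
  refine (IsGreatest.csSup_eq ⟨?_, ?_⟩).symm
  · obtain ⟨e', he', hbest⟩ := exists_likelihood_eq_best w hne
    obtain ⟨e, x, rfl⟩ := exists_extendBlock_eq n m j e'
    obtain ⟨he, hC, hsuf⟩ := (extendBlock_mem_candSet_iff n m j C e x σ').1 he'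
    refine ⟨suffixOf n m j e, x, ⟨e, he⟩, hC, hsuf, le_antisymm ?_ (hupper _ x ⟨e, he⟩ hC hsuf)⟩
    rw [← hbest, likelihood_extendBlock]
    gcongr
    exact likelihood_le_best w he
  · rintro y ⟨σ, x, hσ, hC, hsuf, rfl⟩
    exact hupper σ x hσ hC hsuf
end

section
/- Let F := RatFunc (ZMod 2) and let σ : F →+* F be a ring homomorphism with σ(X) = X⁻¹ and σ ∘ σ = id. Fix natural numbers r, t, k, let A be an r×r diagonal matrix over F with nonzero diagonal entries, K a t×t diagonal matrix over F with nonzero diagonal entries, and let B : r×t, C : r×k, E : r×r, F' : r×t, G : r×k, J : t×r, L : t×k be matrices over F, and Λ ∈ F be nonzero. Define U₂ := Λ • (σ applied entrywise to L)ᵀ · (σ applied entrywise to K)⁻¹ (a k×t matrix), U₃ := Λ • (1 : Matrix k k), and V₁ := (U₂ · (σ(F'))ᵀ + Λ • (σ(G))ᵀ) · (σ(A))⁻¹ (a k×r matrix). Then: A · (σ(V₁))ᵀ + F' · (σ(U₂))ᵀ + G · (σ(U₃))ᵀ = 0 and K · (σ(U₂))ᵀ + L · (σ(U₃))ᵀ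 = 0. -/
open Matrix

set_option synthInstance.maxHeartbeats 1000000
set_option maxHeartbeats 1000000

namespace Matrix

variable {F m n : Type*} [Field F] [Fintype n] [DecidableEq n]

theorem IsDiag.isUnit_det {D : Matrix n n F} (hD : D.IsDiag) (hne : ∀ i, D i i ≠ 0) :
    IsUnit D.det := by
  rw [← hD.diagonal_diag, det_diagonal, isUnit_iff_ne_zero]
  exact Finset.prod_ne_zero_iff.mpr fun i _ => hne i

theorem map_map_of_comp_eq_id {l : Type*} {σ : F →+* F} (hσ : σ.comp σ = RingHom.id F)
    (M : Matrix m l F) : (M.map σ).map σ = M := by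
  ext i j
  exact RingHom.congr_fun hσ (M i j)

theorem IsDiag.mul_transpose_map_mul_inv_map {σ : F →+* F} (hσ : σ.comp σ = RingHom.id F)
    {D : Matrix n n F} (hD : D.IsDiag) (hne : ∀ i, D i i ≠ 0) (M : Matrix m n F) :
    D * ((M * (D.map σ)⁻¹).map σ)ᵀ = (M.map σ)ᵀ := by
  have hdet : IsUnit (D.map σ).det :=
    (hD.map (map_zero σ)).isUnit_det fun i => (map_ne_zero σ).mpr (hne i)
  conv_rhs => rw [← nonsing_inv_mul_cancel_right (D.map σ) M hdet]
  rw [Matrix.map_mul (L := M * _), map_map_of_comp_eq_id hσ, transpose_mul, hD.isSymm.eq]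

end Matrix

/-- The encoded `X̄` operators constructed from the standard polynomial form
`(A B C | E F' G ; 0 0 0 | J K L)` of the stabilizer generators of a quantum
convolutional code satisfy the generalized commutation constraints with all the
generators. Here `σ` is the involution `D ↦ 1/D` of `RatFunc (ZMod 2)`, applied
entrywise to matrices. -/
theorem encodedX_generalized_commutation
    (σ : RatFunc (ZMod 2) →+* RatFunc (ZMod 2))
    (hσX : σ RatFunc.X = (RatFunc.X)⁻¹)
    (hσσ : σ.comp σ = RingHom.id (RatFunc (ZMod 2)))
    (r t k : ℕ)
    (A : Matrix (Fin r) (Fin r) (RatFunc (ZMod 2)))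
    (hA : A.IsDiag) (hAne : ∀ i, A i i ≠ 0)
    (K : Matrix (Fin t) (Fin t) (RatFunc (ZMod 2)))
    (hK : K.IsDiag) (hKne : ∀ i, K i i ≠ 0)
    (B : Matrix (Fin r) (Fin t) (RatFunc (ZMod 2)))
    (C : Matrix (Fin r) (Fin k) (RatFunc (ZMod 2)))
    (E : Matrix (Fin r) (Fin r) (RatFunc (ZMod 2)))
    (F' : Matrix (Fin r) (Fin t) (RatFunc (ZMod 2)))
    (G : Matrix (Fin r) (Fin k) (RatFunc (ZMod 2)))
    (J : Matrix (Fin t) (Fin r) (RatFunc (ZMod 2)))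
    (L : Matrix (Fin t) (Fin k) (RatFunc (ZMod 2)))
    (Λ : RatFunc (ZMod 2)) (hΛ : Λ ≠ 0)
    (U₂ : Matrix (Fin k) (Fin t) (RatFunc (ZMod 2)))
    (hU₂ : U₂ = Λ • ((L.map σ)ᵀ * (K.map σ)⁻¹))
    (U₃ : Matrix (Fin k) (Fin k) (RatFunc (ZMod 2)))
    (hU₃ : U₃ = Λ • (1 : Matrix (Fin k) (Fin k) (RatFunc (ZMod 2))))
    (V₁ : Matrix (Fin k) (Fin r) (RatFunc (ZMod 2)))
    (hV₁ : V₁ = (U₂ * (F'.map σ)ᵀ + Λ • (G.map σ)ᵀ) * (A.map σ)⁻¹) :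
    A * (V₁.map σ)ᵀ + F' * (U₂.map σ)ᵀ + G * (U₃.map σ)ᵀ = 0 ∧
    K * (U₂.map σ)ᵀ + L * (U₃.map σ)ᵀ = 0 := by
  have hsmul : ∀ {m n : ℕ} (M : Matrix (Fin m) (Fin n) (RatFunc (ZMod 2))),
      (Λ • M).map σ = σ Λ • M.map σ := fun M => by ext; simp
  have : CharP (RatFunc (ZMod 2)) 2 := charP_of_injective_algebraMap' (ZMod 2) 2
  have hadd : ∀ {m n : ℕ} (M : Matrix (Fin m) (Fin n) (RatFunc (ZMod 2))), M + M = 0 :=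
    fun M => by ext; exact CharTwo.add_self_eq_zero _
  have hU₃σ : (U₃.map σ)ᵀ = σ Λ • 1 := by
    rw [hU₃, hsmul, Matrix.map_one σ (map_zero σ) (map_one σ), transpose_smul, transpose_one]
  constructor
  · rw [hV₁, hA.mul_transpose_map_mul_inv_map hσσ hAne, hU₃σ, Matrix.map_add σ (map_add σ),
      Matrix.map_mul, hsmul, transpose_map, transpose_map, map_map_of_comp_eq_id hσσ,
      map_map_of_comp_eq_id hσσ, transpose_add, transpose_mul, transpose_smul,
      transpose_transpose, transpose_transpose, Matrix.mul_smul, Matrix.mul_one, add_assoc]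
    exact hadd _
  · rw [hU₂, ← Matrix.smul_mul, hK.mul_transpose_map_mul_inv_map hσσ hKne, hU₃σ, hsmul,
      transpose_map, map_map_of_comp_eq_id hσσ, transpose_smul, transpose_transpose,
      Matrix.mul_smul, Matrix.mul_one]
    exact hadd _
end
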